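/- For every closed formula φ of the labeled logic L2^l and every symbolic execution trace tr: if the erased formula |φ| evaluated on the erased trace |tr| is true (⟦|φ|(|tr|)⟧ = 1), then φ evaluated on tr is true (⟦φ(tr)⟧ = 1). -/

import Mathlib

set_option linter.unusedVariables false

namespace Proto

/-- Labels: label variables, agent labels `ag i`, adversary labels `adv j`. -/
inductive Label where
  | lvar : ℕ → Label
  | ag : ℕ → Label
  | adv : ℕ → Label
deriving DecidableEq

/-- Sorted object-level variables: agent variables `A_i`, nonce variables
`X^j_{A_i}`, ciphertext variables and signature variables. -/
inductive Var where
  | agentV : ℕ → Var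
  | nonceV : ℕ → ℕ → Var
  | cipherV : ℕ → Var
  | sigV : ℕ → Var
deriving DecidableEq

/-- Agent expressions occurring in key positions: identities or agent variables. -/
inductive AgentE where
  | const : ℕ → AgentE
  | avar : ℕ → AgentE
deriving DecidableEq

/-- Terms.  Labeled terms `T^l` are all terms; unlabeled terms `T` are identified
with the label-free ones (all encryption/signature labels equal to `none`). -/
inductive Term where
  | var : Var → Term
  | agent : ℕ → Term
  | ek : AgentE → Term
  | dk : AgentE → Term
  | sk : AgentE → Term
  | vk : AgentE → Term
  | nonce : ℕ → ℕ → ℕ → Term          -- n(a, j, s)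
  | pair : Term → Term → Term
  | enc : AgentE → Term → Option Label → Term   -- {m}_{ek(a)}^ℓ
  | sign : AgentE → Term → Option Label → Term  -- [m]_{sk(a)}^ℓ
deriving DecidableEq

/-- The erasure map `|·|` : removes all labels and commutes with every other
constructor. -/
def erase : Term → Term
  | .var x => .var x
  | .agent a => .agent a
  | .ek a => .ek a
  | .dk a => .dk a
  | .sk a => .sk a
  | .vk a => .vk a
  | .nonce a j s => .nonce a j s
  | .pair t₁ t₂ => .pair (erase t₁) (erase t₂)
  | .enc a t _ => .enc a (erase t) none
  | .sign a t _ => .sign a (erase t) none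

/-- Simple terms: agent variables, nonce variables, agent identities, nonces. -/
inductive Term.Simple : Term → Prop
  | agv (i : ℕ) : Term.Simple (.var (.agentV i))
  | nov (i j : ℕ) : Term.Simple (.var (.nonceV i j))
  | agent (a : ℕ) : Term.Simple (.agent a)
  | nonce (a j s : ℕ) : Term.Simple (.nonce a j s)

/-- A term contains an encryption or a signature subterm. -/
inductive HasCrypt : Term → Prop
  | enc (a : AgentE) (t : Term) (l : Option Label) : HasCrypt (.enc a t l)
  | sign (a : AgentE) (t : Term) (l : Option Label) : HasCrypt (.sign a t l)
  | pairL {t₁ : Term} (t₂ : Term) : HasCrypt t₁ → HasCrypt (.pair t₁ t₂)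
  | pairR (t₁ : Term) {t₂ : Term} : HasCrypt t₂ → HasCrypt (.pair t₁ t₂)

/-- The labeled Dolev-Yao deduction relation `S ⊢ˡ m`. -/
inductive LDeduce : Set Term → Term → Prop
  | mem {S : Set Term} {m : Term} : m ∈ S → LDeduce S m
  | agentK (S : Set Term) (b : ℕ) : LDeduce S (.agent b)
  | ekK (S : Set Term) (b : ℕ) : LDeduce S (.ek (.const b))
  | vkK (S : Set Term) (b : ℕ) : LDeduce S (.vk (.const b))
  | pairI {S m₁ m₂} : LDeduce S m₁ → LDeduce S m₂ → LDeduce S (.pair m₁ m₂)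
  | fstE {S m₁ m₂} : LDeduce S (.pair m₁ m₂) → LDeduce S m₁
  | sndE {S m₁ m₂} : LDeduce S (.pair m₁ m₂) → LDeduce S m₂
  | encI {S b m} (i : ℕ) : LDeduce S (.ek b) → LDeduce S m →
      LDeduce S (.enc b m (some (.adv i)))
  | decI {S b m l} : LDeduce S (.enc b m l) → LDeduce S (.dk b) → LDeduce S m
  | signI {S b m} (i : ℕ) : LDeduce S (.sk b) → LDeduce S m →
      LDeduce S (.sign b m (some (.adv i)))
  | signE {S b m l} : LDeduce S (.sign b m l) → LDeduce S m

/-- The unlabeled Dolev-Yao deduction relation `S ⊢ m` (same rules, labels removed). -/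
inductive UDeduce : Set Term → Term → Prop
  | mem {S : Set Term} {m : Term} : m ∈ S → UDeduce S m
  | agentK (S : Set Term) (b : ℕ) : UDeduce S (.agent b)
  | ekK (S : Set Term) (b : ℕ) : UDeduce S (.ek (.const b))
  | vkK (S : Set Term) (b : ℕ) : UDeduce S (.vk (.const b))
  | pairI {S m₁ m₂} : UDeduce S m₁ → UDeduce S m₂ → UDeduce S (.pair m₁ m₂)
  | fstE {S m₁ m₂} : UDeduce S (.pair m₁ m₂) → UDeduce S m₁
  | sndE {S m₁ m₂} : UDeduce S (.pair m₁ m₂) → UDeduce S m₂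
  | encI {S b m} : UDeduce S (.ek b) → UDeduce S m → UDeduce S (.enc b m none)
  | decI {S b m l} : UDeduce S (.enc b m l) → UDeduce S (.dk b) → UDeduce S m
  | signI {S b m} : UDeduce S (.sk b) → UDeduce S m → UDeduce S (.sign b m none)
  | signE {S b m l} : UDeduce S (.sign b m l) → UDeduce S m

/-- Sort-respecting (partial) substitutions: agent variables go to identities,
nonce variables to nonces `n(a,j,s)`, ciphertext/signature variables to terms,
label variables to labels. -/
structure Subst where
  agv : ℕ → Option ℕ
  nov : ℕ → ℕ → Option (ℕ × ℕ × ℕ)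
  civ : ℕ → Option Term
  siv : ℕ → Option Term
  lbv : ℕ → Option Label

def Subst.applyA (σ : Subst) : AgentE → AgentE
  | .const a => .const a
  | .avar i =>
    match σ.agv i with
    | some a => .const a
    | none => .avar i

def Subst.applyLb (σ : Subst) : Option Label → Option Label
  | some (.lvar n) =>
    match σ.lbv n with
    | some l => some l
    | none => some (.lvar n)
  | l => l

/-- Homomorphic application of a substitution to a term. -/
def Subst.apply (σ : Subst) : Term → Term
  | .var (.agentV i) =>
    match σ.agv i with
    | some a => .agent a
    | none => .var (.agentV i)
  | .var (.nonceV i j) =>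
    match σ.nov i j with
    | some (a, j', s) => .nonce a j' s
    | none => .var (.nonceV i j)
  | .var (.cipherV i) => (σ.civ i).getD (.var (.cipherV i))
  | .var (.sigV i) => (σ.siv i).getD (.var (.sigV i))
  | .agent a => .agent a
  | .ek a => .ek (σ.applyA a)
  | .dk a => .dk (σ.applyA a)
  | .sk a => .sk (σ.applyA a)
  | .vk a => .vk (σ.applyA a)
  | .nonce a j s => .nonce a j s
  | .pair t₁ t₂ => .pair (σ.apply t₁) (σ.apply t₂)
  | .enc a t l => .enc (σ.applyA a) (σ.apply t) (σ.applyLb l)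
  | .sign a t l => .sign (σ.applyA a) (σ.apply t) (σ.applyLb l)

/-- The erased substitution `|σ|`, with `|σ|(X) = |σ(X)|` (label variables
disappear under erasure). -/
def eraseSubst (σ : Subst) : Subst :=
  { agv := σ.agv
    nov := σ.nov
    civ := fun i => (σ.civ i).map erase
    siv := fun i => (σ.siv i).map erase
    lbv := fun _ => none }

def Subst.union (σ θ : Subst) : Subst :=
  { agv := fun i => (σ.agv i).orElse fun _ => θ.agv i
    nov := fun i j => (σ.nov i j).orElse fun _ => θ.nov i j
    civ := fun i => (σ.civ i).orElse fun _ => θ.civ i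
    siv := fun i => (σ.siv i).orElse fun _ => θ.siv i
    lbv := fun i => (σ.lbv i).orElse fun _ => θ.lbv i }

def Subst.empty : Subst :=
  ⟨fun _ => none, fun _ _ => none, fun _ => none, fun _ => none, fun _ => none⟩

/-! ## The execution model -/

/-- Session identifiers `(n, j, (a_1, ..., a_k))`. -/
abbrev SessionId := ℕ × ℕ × List ℕ

/-- Local states `(σ, i, p)`. -/
abbrev LState := Subst × ℕ × ℕ

/-- Global states `(SId, f, H)` (the corrupted agents of the initial corrupt
action, if any, are recorded in the state). -/
structure GState where
  sids : List SessionId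
  f : SessionId → Option LState
  H : Set Term
  corrupted : List ℕ

/-- A protocol maps each role index to a sequence of
(expected pattern, response) pairs; `none` stands for `init` / `stop`. -/
abbrev Protocol := ℕ → List (Option Term × Option Term)

/-- Symbolic execution traces (most recent global state first). -/
abbrev Trace := List GState

/-- The knowledge of an agent: its secret keys and its nonces. -/
def kn (a : ℕ) : Set Term :=
  {t | t = .dk (.const a) ∨ t = .sk (.const a) ∨ ∃ j s, t = .nonce a j s}

def initG : GState := ⟨[], fun _ => none, ∅, []⟩

def corruptG (as : List ℕ) : GState :=
  { initG with H := {t | ∃ a ∈ as, t ∈ kn a}, corrupted := as }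

/-- The initial partial substitution of a new session of role `i` with agents
`as` and session number `s`: agent variables are instantiated to the agents,
and the nonce variables of role `i` to fresh nonces `n(a_i, j, s)`. -/
def initSubst (i : ℕ) (as : List ℕ) (s : ℕ) : Subst :=
  { agv := fun j => as[j-1]?
    nov := fun i' j => if i' = i then (as[i-1]?).map (fun a => (a, j, s)) else none
    civ := fun _ => none
    siv := fun _ => none
    lbv := fun _ => none }

def newG (g : GState) (i : ℕ) (as : List ℕ) : GState :=
  let s := g.sids.length + 1
  { g with
    sids := (s, i, as) :: g.sids
    f := Function.update g.f (s, i, as) (some (initSubst i as s, i, 1)) }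

/-- `MatchPat σ θ lp m`: the message `m` matches the (optional) pattern `lp`
instantiated by `σ`, via the substitution `θ`. -/
def MatchPat (σ θ : Subst) (lp : Option Term) (m : Term) : Prop :=
  match lp with
  | some l => m = θ.apply (σ.apply l)
  | none => θ = Subst.empty

def sendG (g : GState) (sid : SessionId) (σ : Subst) (j p : ℕ)
    (rr : Option Term) (θ : Subst) : GState :=
  { g with
    f := Function.update g.f sid (some (σ.union θ, j, p+1))
    H := match rr with
         | some r => insert (θ.apply (σ.apply r)) g.H
         | none => g.H }

def CanMatch (P : Protocol) (g : GState) (sid : SessionId) (m : Term) : Prop :=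
  ∃ σ j p lp rr θ,
    g.f sid = some (σ, j, p) ∧ (P j)[p-1]? = some (lp, rr) ∧ MatchPat σ θ lp m

/-- The effect of a `send(sid, m)` transition: either the message matches the
expected pattern and the session advances, or the state is left unchanged. -/
inductive SendStep (P : Protocol) (g : GState) (sid : SessionId) (m : Term) :
    GState → Prop
  | succ {σ : Subst} {j p : ℕ} {lp rr : Option Term} {θ : Subst} :
      g.f sid = some (σ, j, p) → (P j)[p-1]? = some (lp, rr) →
      MatchPat σ θ lp m → SendStep P g sid m (sendG g sid σ j p rr θ)
  | fail : ¬ CanMatch P g sid m → SendStep P g sid m g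

/-- Valid execution traces of protocol `P` with respect to a deduction relation
`D` : every adversary-sent message must be deducible (by `D`) from the current
knowledge, and a corrupt action may occur only as first transition. -/
inductive ExecD (D : Set Term → Term → Prop) (P : Protocol) : Trace → Prop
  | start : ExecD D P [initG]
  | corrupt (as : List ℕ) : ExecD D P [corruptG as, initG]
  | new {tr : Trace} {g : GState} (i : ℕ) (as : List ℕ) :
      ExecD D P (g :: tr) → ExecD D P (newG g i as :: g :: tr)
  | send {tr : Trace} {g g' : GState} (sid : SessionId) (m : Term) :
      ExecD D P (g :: tr) → D g.H m → SendStep P g sid m g' →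
      ExecD D P (g' :: g :: tr)

/-- `tr ∈ Exec(Π)` for the labeled model. -/
def LExec (P : Protocol) : Trace → Prop := ExecD LDeduce P

/-- `tr ∈ Exec(Π)` for the unlabeled model. -/
def UExec (P : Protocol) : Trace → Prop := ExecD UDeduce P

/-- Erasure of global states. -/
def eraseState (g : GState) : GState :=
  { sids := g.sids
    f := fun s => (g.f s).map fun x => (eraseSubst x.1, x.2.1, x.2.2)
    H := erase '' g.H
    corrupted := g.corrupted }

/-- Erasure of traces. -/
def eraseTrace : Trace → Trace := List.map eraseState

/-- Erasure of protocols. -/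
def eraseProt (P : Protocol) : Protocol :=
  fun i => (P i).map fun x => (x.1.map erase, x.2.map erase)

/-! ## The security logic -/

/-- Agent expressions of the extended term algebra `T_Sub`: identities or
meta-substitution variables applied to agent variables. -/
inductive SAgentE where
  | const : ℕ → SAgentE
  | svar : ℕ → ℕ → SAgentE        -- ς_k(A_i)
deriving DecidableEq

inductive SLabel where
  | ag : ℕ → SLabel
  | adv : ℕ → SLabel
  | svar : ℕ → ℕ → SLabel         -- ς_k(x_l)
deriving DecidableEq

/-- Terms of the extended algebra `T_Sub^l`, with applications `ς_k(x)` of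
meta-variables for substitutions to object variables. -/
inductive STerm where
  | svar : ℕ → Var → STerm        -- ς_k(x)
  | agent : ℕ → STerm
  | ek : SAgentE → STerm
  | dk : SAgentE → STerm
  | sk : SAgentE → STerm
  | vk : SAgentE → STerm
  | nonce : ℕ → ℕ → ℕ → STerm
  | pair : STerm → STerm → STerm
  | enc : SAgentE → STerm → Option SLabel → STerm
  | sign : SAgentE → STerm → Option SLabel → STerm
deriving DecidableEq

def evalA (η : ℕ → Subst) : SAgentE → AgentE
  | .const a => .const a
  | .svar k i =>
    match (η k).agv i with
    | some a => .const a
    | none => .avar i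

def evalLb (η : ℕ → Subst) : Option SLabel → Option Label
  | none => none
  | some (.ag i) => some (.ag i)
  | some (.adv i) => some (.adv i)
  | some (.svar k n) =>
    match (η k).lbv n with
    | some l => some l
    | none => some (.lvar n)

/-- Interpretation of an extended term under an assignment `η` of the
meta-variables for substitutions. -/
def evalT (η : ℕ → Subst) : STerm → Term
  | .svar k x => (η k).apply (.var x)
  | .agent a => .agent a
  | .ek a => .ek (evalA η a)
  | .dk a => .dk (evalA η a)
  | .sk a => .sk (evalA η a)
  | .vk a => .vk (evalA η a)
  | .nonce a j s => .nonce a j s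
  | .pair t₁ t₂ => .pair (evalT η t₁) (evalT η t₂)
  | .enc a t l => .enc (evalA η a) (evalT η t) (evalLb η l)
  | .sign a t l => .sign (evalA η a) (evalT η t) (evalLb η l)

/-- Erasure on extended terms (`|ς(x)| = ς(x)`). -/
def eraseST : STerm → STerm
  | .svar k x => .svar k x
  | .agent a => .agent a
  | .ek a => .ek a
  | .dk a => .dk a
  | .sk a => .sk a
  | .vk a => .vk a
  | .nonce a j s => .nonce a j s
  | .pair t₁ t₂ => .pair (eraseST t₁) (eraseST t₂)
  | .enc a t _ => .enc a (eraseST t) none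
  | .sign a t _ => .sign a (eraseST t) none

/-- Erasure of assignments of the substitution meta-variables. -/
def eraseEnv (η : ℕ → Subst) : ℕ → Subst := fun k => eraseSubst (η k)

/-- Formulas of the logic `L1` (labeled: `L1^l`; the unlabeled logic `L1` is
obtained over erased terms).  `fa i p k F` is `∀LS_{i,p}(tr) ς_k. F` and
`ex i p k F` is `∃LS_{i,p}(tr) ς_k. F`. -/
inductive Formula where
  | nc : STerm → Formula
  | eq : STerm → STerm → Formula
  | not : Formula → Formula
  | and : Formula → Formula → Formula
  | or : Formula → Formula → Formula
  | fa : ℕ → ℕ → ℕ → Formula → Formula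
  | ex : ℕ → ℕ → ℕ → Formula → Formula

/-- Erasure of formulas. -/
def eraseF : Formula → Formula
  | .nc t => .nc (eraseST t)
  | .eq t₁ t₂ => .eq (eraseST t₁) (eraseST t₂)
  | .not F => .not (eraseF F)
  | .and F₁ F₂ => .and (eraseF F₁) (eraseF F₂)
  | .or F₁ F₂ => .or (eraseF F₁) (eraseF F₂)
  | .fa i p k F => .fa i p k (eraseF F)
  | .ex i p k F => .ex i p k (eraseF F)

/-- The local states `LS_{i,p}(tr)` for role `i` at control point `p`
occurring in the trace `tr` (their substitution components). -/
def LS (i p : ℕ) (tr : Trace) : Set Subst :=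
  {σ | ∃ g ∈ tr, ∃ s, g.f s = some (σ, i, p)}

/-- Interpretation of `NC(tr, t)`: `t` denotes an agent identity that does not
appear in the (initial) corrupt action of `tr`. -/
def NCsem (tr : Trace) (η : ℕ → Subst) (t : STerm) : Prop :=
  ∃ a, evalT η t = .agent a ∧ ∀ g ∈ tr, a ∉ g.corrupted

/-- Semantics `⟦F(tr)⟧ = 1` of formulas (under an assignment `η` of the
substitution meta-variables; equality is syntactic). -/
def Sem (tr : Trace) : Formula → (ℕ → Subst) → Prop
  | .nc t, η => NCsem tr η t
  | .eq t₁ t₂, η => evalT η t₁ = evalT η t₂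
  | .not F, η => ¬ Sem tr F η
  | .and F₁ F₂, η => Sem tr F₁ η ∧ Sem tr F₂ η
  | .or F₁ F₂, η => Sem tr F₁ η ∨ Sem tr F₂ η
  | .fa i p k F, η => ∀ θ ∈ LS i p tr, Sem tr F (Function.update η k θ)
  | .ex i p k F, η => ∃ θ ∈ LS i p tr, Sem tr F (Function.update η k θ)

/-- `Π ⊨ φ` in the labeled model. -/
def LSat (P : Protocol) (φ : Formula) : Prop :=
  ∀ tr, LExec P tr → ∀ η, Sem tr φ η

/-- `Π ⊨ φ` in the unlabeled model. -/
def USat (P : Protocol) (φ : Formula) : Prop :=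
  ∀ tr, UExec P tr → ∀ η, Sem tr φ η

/-- Simple extended terms: meta-variables applied to agent or nonce variables,
agent identities, and nonces. -/
inductive STerm.Simple : STerm → Prop
  | agv (k i : ℕ) : STerm.Simple (.svar k (.agentV i))
  | nov (k i j : ℕ) : STerm.Simple (.svar k (.nonceV i j))
  | agent (a : ℕ) : STerm.Simple (.agent a)
  | nonce (a j s : ℕ) : STerm.Simple (.nonce a j s)

/-- The fragment `L2` (`L2^l`): no arbitrary negation, inequality tests between
arbitrary terms, equality tests between simple terms only. -/
inductive IsL2 : Formula → Prop
  | nc (t : STerm) : IsL2 (.nc t)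
  | nnc (t : STerm) : IsL2 (.not (.nc t))
  | and {F₁ F₂ : Formula} : IsL2 F₁ → IsL2 F₂ → IsL2 (.and F₁ F₂)
  | or {F₁ F₂ : Formula} : IsL2 F₁ → IsL2 F₂ → IsL2 (.or F₁ F₂)
  | neq (t₁ t₂ : STerm) : IsL2 (.not (.eq t₁ t₂))
  | eq {u₁ u₂ : STerm} : u₁.Simple → u₂.Simple → IsL2 (.eq u₁ u₂)
  | fa (i p k : ℕ) {F : Formula} : IsL2 F → IsL2 (.fa i p k F)
  | ex (i p k : ℕ) {F : Formula} : IsL2 F → IsL2 (.ex i p k F)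

end Proto

namespace Proto

theorem evalA_eraseEnv (η : ℕ → Subst) (a : SAgentE) :
    evalA (eraseEnv η) a = evalA η a := by
  cases a <;> rfl

theorem evalT_erase (η : ℕ → Subst) (t : STerm) :
    evalT (eraseEnv η) (eraseST t) = erase (evalT η t) := by
  induction t with
  | svar k x =>
    cases x with
    | agentV i =>
      simp only [eraseST, evalT, Subst.apply, eraseEnv, eraseSubst]
      cases (η k).agv i <;> rfl
    | nonceV i j =>
      simp only [eraseST, evalT, Subst.apply, eraseEnv, eraseSubst]
      cases (η k).nov i j <;> rfl
    | cipherV i =>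
      simp only [eraseST, evalT, Subst.apply, eraseEnv, eraseSubst]
      cases (η k).civ i <;> rfl
    | sigV i =>
      simp only [eraseST, evalT, Subst.apply, eraseEnv, eraseSubst]
      cases (η k).siv i <;> rfl
  | _ => simp_all [eraseST, evalT, erase, evalA_eraseEnv, evalLb]

theorem erase_eq_agent (t : Term) (a : ℕ) : erase t = .agent a ↔ t = .agent a := by
  cases t <;> simp [erase]

theorem erase_simple (η : ℕ → Subst) {u : STerm} (hu : u.Simple) :
    erase (evalT η u) = evalT η u := by
  cases hu with
  | agv k i =>
    simp only [evalT, Subst.apply]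
    cases (η k).agv i <;> rfl
  | nov k i j =>
    simp only [evalT, Subst.apply]
    cases (η k).nov i j <;> rfl
  | agent a => rfl
  | nonce a j s => rfl

theorem NCsem_erase (tr : Trace) (η : ℕ → Subst) (t : STerm) :
    NCsem (eraseTrace tr) (eraseEnv η) (eraseST t) ↔ NCsem tr η t := by
  simp [NCsem, evalT_erase, erase_eq_agent, eraseTrace, eraseState]

theorem eraseEnv_update (η : ℕ → Subst) (k : ℕ) (θ : Subst) :
    eraseEnv (Function.update η k θ) = Function.update (eraseEnv η) k (eraseSubst θ) := by
  funext j
  by_cases hj : j = k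
  · subst hj; simp [eraseEnv]
  · simp [eraseEnv, hj]

theorem LS_erase (i p : ℕ) (tr : Trace) :
    LS i p (eraseTrace tr) = eraseSubst '' LS i p tr := by
  ext σ
  constructor
  · rintro ⟨g, hg, s, hs⟩
    obtain ⟨g', hg', rfl⟩ := List.mem_map.1 hg
    obtain ⟨⟨θ, i', p'⟩, h1, h2⟩ := Option.map_eq_some_iff.1 hs
    simp only [Prod.mk.injEq] at h2
    obtain ⟨rfl, rfl, rfl⟩ := h2
    exact ⟨θ, ⟨g', hg', s, h1⟩, rfl⟩
  · rintro ⟨θ, ⟨g, hg, s, hs⟩, rfl⟩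
    exact ⟨eraseState g, List.mem_map.2 ⟨g, hg, rfl⟩, s, by simp [eraseState, hs]⟩

/-- Lemma 3: for every formula `φ` of `L2^l` and every symbolic
execution trace `tr`, if `⟦|φ|(|tr|)⟧ = 1` then `⟦φ(tr)⟧ = 1`. -/
theorem sem_erase (φ : Formula) (hφ : IsL2 φ) (tr : Trace) (η : ℕ → Subst)
    (h : Sem (eraseTrace tr) (eraseF φ) (eraseEnv η)) :
    Sem tr φ η := by
  induction hφ generalizing η with
  | nc t => exact (NCsem_erase tr η t).1 h
  | nnc t => exact fun h' => h ((NCsem_erase tr η t).2 h')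
  | and _ _ ih₁ ih₂ => exact ⟨ih₁ η h.1, ih₂ η h.2⟩
  | or _ _ ih₁ ih₂ => exact h.imp (ih₁ η) (ih₂ η)
  | neq t₁ t₂ =>
    intro h'
    apply h
    simp only [eraseF, Sem] at h' ⊢
    rw [evalT_erase, evalT_erase, h']
  | eq h₁ h₂ =>
    simp only [eraseF, Sem] at h ⊢
    rwa [evalT_erase, evalT_erase, erase_simple η h₁, erase_simple η h₂] at h
  | fa i p k _ ih =>
    intro θ hθ
    apply ih
    rw [eraseEnv_update]
    exact h _ (by rw [LS_erase]; exact ⟨θ, hθ, rfl⟩)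
  | ex i p k _ ih =>
    obtain ⟨θ', hθ', h⟩ := h
    rw [LS_erase] at hθ'
    obtain ⟨θ, hθ, rfl⟩ := hθ'
    refine ⟨θ, hθ, ih _ ?_⟩
    rw [eraseEnv_update]
    exact h

end Proto
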